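/- For every δ with 0 < δ < 1/4 there exist α > 0 and j₀ such that: for every (j,n) ∈ P with |j| > j₀, every admissible L for Λ_j, and every square Λ = ([−M²+1, M²−1] ∩ ℤ)² with Λ_j ⊆ Λ, if λ* is an eigenvalue of H_{Λ_j} with λ* ∈ [−2δ, 2δ], then there exists an eigenvalue λ of H_Λ with |λ − λ*| ≤ e^{−α|j|}. -/

import Mathlib

noncomputable section

/-- The finite-volume Floquet Hamiltonian `H_S` on a finite set `S ⊆ ℤ × ℤ`:
diagonal entries `n + j²`, entries `δ` between `(j,n)` and `(j',n')` with
`|j−j'| = 1` and `|n−n'| = 1`, all other entries `0`. -/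
def Hmat (δ : ℝ) (S : Finset (ℤ × ℤ)) : Matrix S S ℝ := fun x y =>
  if (x : ℤ × ℤ) = (y : ℤ × ℤ) then (((x : ℤ × ℤ).2 + (x : ℤ × ℤ).1 ^ 2 : ℤ) : ℝ)
  else if |(x : ℤ × ℤ).1 - (y : ℤ × ℤ).1| = 1 ∧ |(x : ℤ × ℤ).2 - (y : ℤ × ℤ).2| = 1 then δ
  else 0

/-- `μ` is an eigenvalue of the real symmetric matrix `H_S`. -/
def IsEigen (δ : ℝ) (S : Finset (ℤ × ℤ)) (μ : ℝ) : Prop :=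
  ∃ v : S → ℝ, v ≠ 0 ∧ (Hmat δ S).mulVec v = μ • v

/-- The square `Λ_j` of side `2L` centered at `(j, n)`. -/
def sqΛ (j n L : ℤ) : Finset (ℤ × ℤ) :=
  Finset.Icc (j - L) (j + L) ×ˢ Finset.Icc (n - L) (n + L)

/-- The square `([−m, m] ∩ ℤ)²` as a finite subset of `ℤ × ℤ`. -/
def bigSq (m : ℤ) : Finset (ℤ × ℤ) := Finset.Icc (-m) m ×ˢ Finset.Icc (-m) m

/-- The potential `n + j²` at the lattice site `(j, n)`. -/
def potential (x : ℤ × ℤ) : ℤ := x.2 + x.1 ^ 2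

/-- The sum of `f` over the four diagonal neighbours of `x`. -/
def diagSum (f : ℤ × ℤ → ℝ) (x : ℤ × ℤ) : ℝ :=
  f (x.1 + 1, x.2 + 1) + f (x.1 + 1, x.2 - 1) + f (x.1 - 1, x.2 + 1) + f (x.1 - 1, x.2 - 1)

lemma abs_diagSum_le {f : ℤ × ℤ → ℝ} {x : ℤ × ℤ} {K : ℝ}
    (h : ∀ y : ℤ × ℤ, |y.1 - x.1| = 1 → |y.2 - x.2| = 1 → |f y| ≤ K) :
    |diagSum f x| ≤ 4 * K := by
  have h1 := abs_le.1 (h (x.1 + 1, x.2 + 1) (by simp) (by simp))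
  have h2 := abs_le.1 (h (x.1 + 1, x.2 - 1) (by simp) (by simp))
  have h3 := abs_le.1 (h (x.1 - 1, x.2 + 1) (by simp) (by simp))
  have h4 := abs_le.1 (h (x.1 - 1, x.2 - 1) (by simp) (by simp))
  unfold diagSum
  rw [abs_le]
  constructor <;> linarith

/-- The action of `Hmat` on the restriction of a function vanishing outside `S`. -/
lemma Hmat_mulVec_restrict (δ : ℝ) (S : Finset (ℤ × ℤ)) (f : ℤ × ℤ → ℝ)
    (hf : ∀ x ∉ S, f x = 0) (x : S) :
    (Hmat δ S).mulVec (fun y => f y) x = (potential x : ℝ) * f x + δ * diagSum f x := by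
  obtain ⟨⟨a, b⟩, hx⟩ := x
  let g : ℤ × ℤ → ℝ := fun y =>
    (if (a, b) = y then ((b + a ^ 2 : ℤ) : ℝ)
      else if |a - y.1| = 1 ∧ |b - y.2| = 1 then δ else 0) * f y
  have h1 : (Hmat δ S).mulVec (fun y => f y) ⟨(a, b), hx⟩ = ∑ y ∈ S, g y := by
    rw [← Finset.sum_coe_sort S g]
    rfl
  let T : Finset (ℤ × ℤ) :=
    {(a, b), (a + 1, b + 1), (a + 1, b - 1), (a - 1, b + 1), (a - 1, b - 1)}
  have h2 : ∑ y ∈ S, g y = ∑ y ∈ S ∪ T, g y := by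
    refine Finset.sum_subset Finset.subset_union_left fun y _ hy => ?_
    simp [g, hf y hy]
  have h3 : ∑ y ∈ T, g y = ∑ y ∈ S ∪ T, g y := by
    refine Finset.sum_subset Finset.subset_union_right fun y _ hy => ?_
    obtain ⟨c, d⟩ := y
    simp only [T, Finset.mem_insert, Finset.mem_singleton, Prod.mk.injEq, not_or] at hy
    have e1 : ¬ ((a, b) = (c, d)) := by simp only [Prod.mk.injEq]; omega
    have e2 : ¬ (|a - c| = 1 ∧ |b - d| = 1) := by
      rw [abs_eq (by norm_num), abs_eq (by norm_num)]
      omega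
    simp only [g, if_neg e1, if_neg e2, zero_mul]
  rw [h1, h2, ← h3]
  simp only [T]
  rw [Finset.sum_insert (by simp; omega), Finset.sum_insert (by simp; omega),
    Finset.sum_insert (by simp; omega), Finset.sum_insert (by simp; omega),
    Finset.sum_singleton]
  have hab : ¬ (a = a - 1 ∧ b = b - 1) := by omega
  simp [g, potential, diagSum, hab]
  ring

lemma Hmat_isHermitian (δ : ℝ) (S : Finset (ℤ × ℤ)) : (Hmat δ S).IsHermitian := by
  ext x y
  simp only [Matrix.conjTranspose_apply, star_trivial, Hmat]
  by_cases h : (x : ℤ × ℤ) = y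
  · simp [h]
  · rw [if_neg h, if_neg (Ne.symm h), abs_sub_comm, abs_sub_comm (y : ℤ × ℤ).2]

/-- A quasi-mode of accuracy `ε` lies within `ε` of an eigenvalue. -/
lemma exists_eigenvalue_near {ι : Type*} [Fintype ι] [DecidableEq ι] {A : Matrix ι ι ℝ}
    (hA : A.IsHermitian) {v : ι → ℝ} (hv : v ≠ 0) {μ ε : ℝ} (hε : 0 ≤ ε)
    (h : ∑ i, (A.mulVec v i - μ * v i) ^ 2 ≤ ε ^ 2 * ∑ i, v i ^ 2) :
    ∃ lam : ℝ, (∃ w : ι → ℝ, w ≠ 0 ∧ A.mulVec w = lam • w) ∧ |lam - μ| ≤ ε := by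
  by_contra! hne
  let b := hA.eigenvectorBasis
  have hgap : ∀ i, ε < |hA.eigenvalues i - μ| := fun i =>
    hne _ ⟨(b i).ofLp, fun h0 => b.orthonormal.ne_zero i (by ext k; exact congrFun h0 k),
      hA.mulVec_eigenvectorBasis i⟩
  let u : EuclideanSpace ℝ ι := WithLp.toLp 2 v
  let r : EuclideanSpace ℝ ι := WithLp.toLp 2 (A.mulVec v - μ • v)
  have hinner : ∀ i, inner ℝ (b i) r = (hA.eigenvalues i - μ) * inner ℝ (b i) u := by
    intro i
    have hsym : (b i).ofLp ⬝ᵥ A.mulVec v = hA.eigenvalues i * ((b i).ofLp ⬝ᵥ v) := by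
      rw [Matrix.dotProduct_mulVec, ← Matrix.mulVec_transpose]
      have : A.transpose = A := by simpa using hA.eq
      rw [this, hA.mulVec_eigenvectorBasis i, smul_dotProduct, smul_eq_mul]
    have h1 : inner ℝ (b i) r = (b i).ofLp ⬝ᵥ (A.mulVec v - μ • v) := by
      simp [r, EuclideanSpace.inner_eq_star_dotProduct, dotProduct_comm]
    have h2 : inner ℝ (b i) u = (b i).ofLp ⬝ᵥ v := by
      simp [u, EuclideanSpace.inner_eq_star_dotProduct, dotProduct_comm]
    rw [h1, h2, dotProduct_sub, hsym, dotProduct_smul, smul_eq_mul]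
    ring
  have hr : ‖r‖ ^ 2 ≤ ε ^ 2 * ‖u‖ ^ 2 := by
    simpa [EuclideanSpace.norm_sq_eq, r, u] using h
  rw [← b.sum_sq_norm_inner_right r, ← b.sum_sq_norm_inner_right u, Finset.mul_sum] at hr
  have hu : u ≠ 0 := fun h0 => hv (by simpa [u] using h0)
  obtain ⟨i, hi⟩ : ∃ i, inner ℝ (b i) u ≠ 0 := by
    by_contra! h0
    refine hu (norm_eq_zero.1 (pow_eq_zero_iff (two_ne_zero) |>.1 ?_))
    rw [← b.sum_sq_norm_inner_right u]
    simp [h0]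
  have hsq : ∀ i, ε ^ 2 < (hA.eigenvalues i - μ) ^ 2 := fun i => by
    rw [← sq_abs (hA.eigenvalues i - μ)]
    exact pow_lt_pow_left₀ (hgap i) hε two_ne_zero
  refine absurd hr (not_le.2 (Finset.sum_lt_sum (fun k _ => ?_) ⟨i, Finset.mem_univ i, ?_⟩))
  · rw [hinner k, Real.norm_eq_abs, Real.norm_eq_abs, sq_abs, sq_abs, mul_pow]
    exact mul_le_mul_of_nonneg_right (hsq k).le (sq_nonneg _)
  · rw [hinner i, Real.norm_eq_abs, Real.norm_eq_abs, sq_abs, sq_abs, mul_pow]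
    exact mul_lt_mul_of_pos_right (hsq i) (by positivity)

lemma mem_sqΛ {j n L : ℤ} {x : ℤ × ℤ} :
    x ∈ sqΛ j n L ↔ |x.1 - j| ≤ L ∧ |x.2 - n| ≤ L := by
  simp only [sqΛ, Finset.mem_product, Finset.mem_Icc, abs_le]
  constructor <;> rintro ⟨⟨_, _⟩, _, _⟩ <;> refine ⟨⟨?_, ?_⟩, ?_, ?_⟩ <;> linarith

/-- The centre of an admissible square is its only resonant site. -/
lemma potential_ne_zero {j n L : ℤ} (hn : n + j ^ 2 = 0) (hj : 1 < |j|)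
    (hL : L ≤ 2 * (|j| - 1)) {x : ℤ × ℤ} (hx : x ∈ sqΛ j n L) (hne : x ≠ (j, n)) :
    potential x ≠ 0 := by
  obtain ⟨a, b⟩ := x
  obtain ⟨hx1, hx2⟩ := mem_sqΛ.1 hx
  simp only [potential] at *
  intro hV
  have hb : |j ^ 2 - a ^ 2| ≤ L := by
    convert hx2 using 2
    linarith
  rw [← sq_abs j, ← sq_abs a, abs_le] at hb
  have haj : |a| = |j| := by
    have ha := abs_nonneg a
    rcases lt_trichotomy |a| |j| with h | h | h
    · nlinarith
    · exact h
    · nlinarith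
  rcases abs_eq_abs.1 haj with rfl | rfl
  · exact hne (Prod.ext rfl (by simp only; linarith))
  · have : |-j - j| = 2 * |j| := by
      rw [show -j - j = -(2 * j) by ring, abs_neg, abs_mul]
      norm_num
    linarith

/-- Sites of small potential in an admissible square have neighbours of large potential. -/
lemma nine_le_abs_potential_of_neighbor {j n L : ℤ} (hn : n + j ^ 2 = 0) (hj : 12 ≤ |j|)
    (hL : L ≤ 2 * (|j| - 1)) {x y : ℤ × ℤ} (hx : x ∈ sqΛ j n L) (hV : |potential x| ≤ 8)
    (h1 : |y.1 - x.1| = 1) (h2 : |y.2 - x.2| = 1) : 9 ≤ |potential y| := by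
  obtain ⟨a, b⟩ := x
  obtain ⟨c, d⟩ := y
  obtain ⟨-, hx2⟩ := mem_sqΛ.1 hx
  simp only [potential] at *
  have ha : 10 ≤ |a| := by
    rw [abs_le] at hx2 hV
    have := sq_abs j
    have := sq_abs a
    by_contra! h
    nlinarith [abs_nonneg a]
  rw [abs_eq (by norm_num)] at h1 h2
  rw [abs_le] at hV
  have hc : c = a + 1 ∨ c = a - 1 := by omega
  have hV' : d + c ^ 2 = b + a ^ 2 + (d - b) + 1 + 2 * a ∨
      d + c ^ 2 = b + a ^ 2 + (d - b) + 1 - 2 * a := by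
    rcases hc with rfl | rfl
    · left; ring
    · right; ring
  rw [le_abs] at ha ⊢
  generalize d + c ^ 2 = p at *
  generalize b + a ^ 2 = q at *
  omega

/-- Pointwise bound on a solution of the eigenvalue equation from a bound on its neighbours. -/
lemma abs_le_of_eigen_eq {δ lam V t s K : ℝ} (hδ0 : 0 < δ) (hδ1 : δ < 1 / 4)
    (hlam : |lam| ≤ 1 / 2) (heq : V * t + δ * s = lam * t) (hs : |s| ≤ 4 * K) {c : ℝ}
    (hV : c + 1 / 2 ≤ |V|) : c * |t| ≤ K := by
  have h1 : |V - lam| * |t| = δ * |s| := by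
    rw [← abs_mul, show δ * |s| = |δ * s| by rw [abs_mul, abs_of_pos hδ0], ← abs_neg (δ * s)]
    congr 1
    linarith
  have h2 : c ≤ |V - lam| := by linarith [abs_sub_abs_le_abs_sub V lam]
  have h3 : δ * |s| ≤ K := by nlinarith [abs_nonneg s]
  have := mul_le_mul_of_nonneg_right h2 (abs_nonneg t)
  linarith

/-- Decay, away from the centre of an admissible square, of solutions of the eigenvalue
equation. -/
lemma abs_le_of_far {δ lam : ℝ} (hδ0 : 0 < δ) (hδ1 : δ < 1 / 4) (hlam : |lam| ≤ 1 / 2)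
    {j n L : ℤ} (hn : n + j ^ 2 = 0) (hj : 12 ≤ |j|) (hL : L ≤ 2 * (|j| - 1))
    {f : ℤ × ℤ → ℝ} (hf : ∀ x ∉ sqΛ j n L, f x = 0)
    (heq : ∀ x ∈ sqΛ j n L, (potential x : ℝ) * f x + δ * diagSum f x = lam * f x)
    {C : ℝ} (hC : ∀ x, |f x| ≤ C) (m : ℕ) (x : ℤ × ℤ)
    (hx : 2 * (m : ℤ) ≤ |x.1 - j| ∨ 2 * (m : ℤ) ≤ |x.2 - n|) :
    |f x| ≤ C / 4 ^ m := by
  have hC0 : 0 ≤ C := (abs_nonneg _).trans (hC x)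
  induction m generalizing x with
  | zero => simpa using hC x
  | succ m ih =>
    set B := C / 4 ^ m with hB
    have hB0 : 0 ≤ B := by positivity
    have hgoal : C / 4 ^ (m + 1) = B / 4 := by rw [hB, pow_succ]; field_simp
    rw [hgoal]
    push_cast at hx
    have hlarge : ∀ y : ℤ × ℤ, 2 * (m : ℤ) + 1 ≤ |y.1 - j| ∨ 2 * (m : ℤ) + 1 ≤ |y.2 - n| →
        9 ≤ |potential y| → |f y| ≤ B / 8 := by
      intro y hy hV
      by_cases hyS : y ∈ sqΛ j n L
      · have hs : |diagSum f y| ≤ 4 * B := abs_diagSum_le fun z h1 h2 => ih z (by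
          rw [abs_eq (by norm_num)] at h1 h2
          rw [le_abs, le_abs] at hy ⊢
          omega)
        have hVr : (8 : ℝ) + 1 / 2 ≤ |(potential y : ℝ)| := by
          have : (9 : ℝ) ≤ |(potential y : ℝ)| := by exact_mod_cast hV
          linarith
        have := abs_le_of_eigen_eq hδ0 hδ1 hlam (heq y hyS) hs hVr
        linarith
      · rw [hf y hyS, abs_zero]
        positivity
    by_cases hV : 9 ≤ |potential x|
    · have := hlarge x (by omega) hV
      linarith
    by_cases hxS : x ∈ sqΛ j n L
    · have hs : |diagSum f x| ≤ 4 * (B / 8) := abs_diagSum_le fun z h1 h2 => by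
        refine hlarge z ?_ (nine_le_abs_potential_of_neighbor hn hj hL hxS (by omega) h1 h2)
        rw [abs_eq (by norm_num)] at h1 h2
        rw [le_abs, le_abs] at hx ⊢
        omega
      have hne : x ≠ (j, n) := by
        rintro rfl
        simp only [sub_self, abs_zero] at hx
        omega
      have hVr : (1 / 2 : ℝ) + 1 / 2 ≤ |(potential x : ℝ)| := by
        have : (1 : ℝ) ≤ |(potential x : ℝ)| := by
          exact_mod_cast Int.one_le_abs (potential_ne_zero hn (by omega) hL hxS hne)
        linarith
      have := abs_le_of_eigen_eq hδ0 hδ1 hlam (heq x hxS) hs hVr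
      linarith
    · rw [hf x hxS, abs_zero]
      positivity

lemma four_mul_add_five_le_two_pow {m : ℕ} (hm : 5 ≤ m) : 4 * m + 5 ≤ 2 ^ m := by
  induction m, hm using Nat.le_induction with
  | base => norm_num
  | succ k hk ih => rw [pow_succ]; omega

/-- The size of the boundary layer is beaten by the decay. -/
lemma boundary_mul_decay_le_exp {J : ℝ} {L : ℤ} {m : ℕ} (hm : 5 ≤ m) (hJ : J ≤ L)
    (hL : L ≤ 2 * m + 1) : (2 * (L : ℝ) + 3) * (1 / 4 ^ m) ≤ Real.exp (-(1 / 8) * J) := by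
  have hLr : (L : ℝ) ≤ 2 * m + 1 := by exact_mod_cast hL
  have hmr : (5 : ℝ) ≤ m := by exact_mod_cast hm
  have h1 : (4 : ℝ) * m + 5 ≤ 2 ^ m := by exact_mod_cast four_mul_add_five_le_two_pow hm
  have h2 : Real.exp ((1 / 8) * J) ≤ 2 ^ m := by
    calc Real.exp ((1 / 8) * J) ≤ Real.exp (m * (1 / 2)) := Real.exp_le_exp.2 (by linarith)
      _ = Real.exp (1 / 2) ^ m := Real.exp_nat_mul _ _
      _ ≤ 2 ^ m := by
        refine pow_le_pow_left₀ (Real.exp_pos _).le ?_ m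
        have h3 : Real.exp (1 / 2) ^ 2 = Real.exp 1 := by
          rw [← Real.exp_nat_mul]; norm_num
        nlinarith [Real.exp_one_lt_d9, Real.exp_pos (1 / 2)]
  have h4 : (4 : ℝ) ^ m = 2 ^ m * 2 ^ m := by rw [← mul_pow]; norm_num
  rw [neg_mul, Real.exp_neg, mul_one_div, h4, div_le_iff₀ (by positivity), ← div_eq_inv_mul,
    le_div_iff₀ (Real.exp_pos _)]
  exact mul_le_mul (by linarith) h2 (Real.exp_pos _).le (by positivity)


/-- eigenvalues of `H_{Λ_j}` in `[−2δ, 2δ]` are exponentially close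
to eigenvalues of `H_Λ` for any larger square `Λ = ([−M²+1, M²−1] ∩ ℤ)² ⊇ Λ_j`. -/
theorem approximate_eigenvalues (δ : ℝ) (hδ0 : 0 < δ) (hδ1 : δ < 1 / 4) :
    ∃ α > (0 : ℝ), ∃ j₀ : ℤ,
      ∀ j n L : ℤ, n + j ^ 2 = 0 → j₀ < |j| → |j| ≤ L → L ≤ 2 * (|j| - 1) →
        ∀ M : ℤ, sqΛ j n L ⊆ bigSq (M ^ 2 - 1) →
          ∀ lamStar : ℝ, IsEigen δ (sqΛ j n L) lamStar →
            lamStar ∈ Set.Icc (-(2 * δ)) (2 * δ) →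
            ∃ lam : ℝ, IsEigen δ (bigSq (M ^ 2 - 1)) lam ∧
              |lam - lamStar| ≤ Real.exp (-α * |(j : ℝ)|) := by
  refine ⟨1 / 8, by norm_num, 12, fun j n L hn hj hjL hL M hsub lamStar hEig hlam => ?_⟩
  set S := sqΛ j n L with hS
  obtain ⟨v, hv0, hv⟩ := hEig
  let f : ℤ × ℤ → ℝ := fun x => if h : x ∈ S then v ⟨x, h⟩ else 0
  have hfv : ∀ x : S, f x = v x := fun x => by simp [f]
  have hf : ∀ x ∉ S, f x = 0 := fun x hx => by simp [f, hx]
  have heq : ∀ x ∈ S, (potential x : ℝ) * f x + δ * diagSum f x = lamStar * f x := by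
    intro x hx
    rw [← Hmat_mulVec_restrict δ S f hf ⟨x, hx⟩, hfv ⟨x, hx⟩]
    simp only [hfv]
    simpa using congrFun hv ⟨x, hx⟩
  have hlam' : |lamStar| ≤ 1 / 2 := by
    rw [abs_le]
    constructor <;> linarith [hlam.1, hlam.2]
  obtain ⟨x₁, hx₁⟩ := Function.ne_iff.1 hv0
  obtain ⟨x₀, hx₀S, hx₀⟩ := S.exists_max_image (fun x => |f x|) ⟨x₁, x₁.2⟩
  set C := |f x₀| with hCdef
  have hC : ∀ x, |f x| ≤ C := fun x => by
    by_cases hx : x ∈ S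
    · exact hx₀ x hx
    · rw [hf x hx, abs_zero]
      exact abs_nonneg _
  have hCpos : 0 < C := (abs_pos.2 (by rw [hfv]; exact hx₁)).trans_le (hC x₁)
  obtain ⟨m, hmL, hLm⟩ : ∃ m : ℕ, 2 * (m : ℤ) ≤ L ∧ L ≤ 2 * m + 1 :=
    ⟨(L / 2).toNat, by omega, by omega⟩
  have hdecay := abs_le_of_far hδ0 hδ1 hlam' hn (by omega) hL hf heq hC m
  set T := bigSq (M ^ 2 - 1) with hT
  set r : ℤ × ℤ → ℝ := fun x => (potential x : ℝ) * f x + δ * diagSum f x - lamStar * f x with hr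
  have hr_bound : ∀ x, |r x| ≤ C / 4 ^ m := by
    intro x
    by_cases hx : x ∈ S
    · simp only [hr, heq x hx, sub_self, abs_zero]
      positivity
    · have hs : |diagSum f x| ≤ 4 * (C / 4 ^ m) := abs_diagSum_le fun y h1 h2 => hdecay y (by
        rw [hS, mem_sqΛ, abs_le, abs_le] at hx
        rw [abs_eq (by norm_num)] at h1 h2
        rw [le_abs, le_abs]
        omega)
      simp only [hr, hf x hx, mul_zero, zero_add, sub_zero, abs_mul, abs_of_pos hδ0]
      nlinarith [abs_nonneg (diagSum f x)]
  have hr_supp : ∀ x ∉ sqΛ j n (L + 1), r x = 0 := by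
    intro x hx
    rw [mem_sqΛ, abs_le, abs_le] at hx
    have hs : |diagSum f x| ≤ 4 * 0 := abs_diagSum_le fun y h1 h2 => by
      rw [hf y, abs_zero]
      rw [hS, mem_sqΛ, abs_le, abs_le]
      rw [abs_eq (by norm_num)] at h1 h2
      omega
    have hfx : f x = 0 := hf x (by
      rw [hS, mem_sqΛ, abs_le, abs_le]
      omega)
    have : diagSum f x = 0 := abs_nonpos_iff.1 (by simpa using hs)
    simp [hr, this, hfx]
  have hcard : ((sqΛ j n (L + 1)).card : ℝ) = (2 * (L : ℝ) + 3) ^ 2 := by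
    have : ((sqΛ j n (L + 1)).card : ℤ) = (2 * L + 3) ^ 2 := by
      simp only [sqΛ, Finset.card_product, Int.card_Icc]
      push_cast
      rw [Int.toNat_of_nonneg (by omega), Int.toNat_of_nonneg (by omega)]
      ring
    exact_mod_cast this
  have hL0 : (0 : ℝ) ≤ L := by exact_mod_cast (by omega : (0 : ℤ) ≤ L)
  have hres : ∑ x ∈ T, r x ^ 2 ≤ ((2 * (L : ℝ) + 3) * (1 / 4 ^ m)) ^ 2 * C ^ 2 := by
    calc ∑ x ∈ T, r x ^ 2 ≤ ∑ x ∈ T ∪ sqΛ j n (L + 1), r x ^ 2 :=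
          Finset.sum_le_sum_of_subset_of_nonneg Finset.subset_union_left
            fun _ _ _ => sq_nonneg _
      _ = ∑ x ∈ sqΛ j n (L + 1), r x ^ 2 :=
          (Finset.sum_subset Finset.subset_union_right
            fun x _ hx => by rw [hr_supp x hx]; norm_num).symm
      _ ≤ ∑ x ∈ sqΛ j n (L + 1), (C / 4 ^ m) ^ 2 :=
          Finset.sum_le_sum fun x _ => by
            rw [← sq_abs]
            exact pow_le_pow_left₀ (abs_nonneg _) (hr_bound x) 2
      _ = ((2 * (L : ℝ) + 3) * (1 / 4 ^ m)) ^ 2 * C ^ 2 := by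
          rw [Finset.sum_const, nsmul_eq_mul, hcard]
          ring
  have hnorm : C ^ 2 ≤ ∑ x ∈ T, f x ^ 2 := by
    rw [hCdef, sq_abs]
    exact Finset.single_le_sum (f := fun x => f x ^ 2) (fun _ _ => sq_nonneg _) (hsub hx₀S)
  have hfT : ∀ x ∉ T, f x = 0 := fun x hx => hf x fun h => hx (hsub h)
  obtain ⟨lam, hlamEig, hle⟩ := exists_eigenvalue_near (Hmat_isHermitian δ T)
    (v := fun x : T => f x) (μ := lamStar) (ε := (2 * (L : ℝ) + 3) * (1 / 4 ^ m))
    (fun h0 => hCpos.ne' (abs_eq_zero.2 (congrFun h0 ⟨x₀, hsub hx₀S⟩))) (by positivity) (by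
      simp only [Hmat_mulVec_restrict δ T f hfT]
      rw [Finset.sum_coe_sort T (fun x => f x ^ 2), Finset.sum_coe_sort T (fun x => r x ^ 2)]
      exact hres.trans (mul_le_mul_of_nonneg_left hnorm (sq_nonneg _)))
  refine ⟨lam, hlamEig, hle.trans (boundary_mul_decay_le_exp (by omega) ?_ hLm)⟩
  exact_mod_cast hjL
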